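/- Let Ω be a complete separable metric space, 𝒫 a nonempty family of Borel probability measures on Ω, and c(A) := sup_{P∈𝒫} P(A). Let (X_n) be a sequence of Borel functions, each bounded quasi-surely and having a quasi-continuous version, which is Cauchy under the norm ‖X‖_∞ := inf{ M ≥ 0 : |X| ≤ M quasi-surely }. Then (X_n) converges in ‖·‖_∞ to some X which is bounded quasi-surely and has a quasi-continuous version. (That is, 𝕃^∞_c := {X ∈ 𝕃^∞ : X has a quasi-continuous version} is a closed linear subspace of the Banach space 𝕃^∞.) -/

import Mathlib

open MeasureTheory Filter Topology ENNReal

/-- The capacity `c(A) = sup_{P ∈ Ps} P(A)` associated to a family of probability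
measures `Ps`. -/
noncomputable def upperCapacity {Ω : Type*} [MeasurableSpace Ω]
    (Ps : Set (MeasureTheory.ProbabilityMeasure Ω)) (A : Set Ω) : ℝ≥0∞ :=
  ⨆ P ∈ Ps, (P : MeasureTheory.Measure Ω) A

/-- A function `Y : Ω → ℝ` is quasi-continuous (w.r.t. the capacity of the family `Ps`)
if for every `ε > 0` there is an open set `O` with `c(O) < ε` such that the restriction
of `Y` to `Oᶜ` is continuous. -/
def UpperQuasiContinuous {Ω : Type*} [TopologicalSpace Ω] [MeasurableSpace Ω]
    (Ps : Set (MeasureTheory.ProbabilityMeasure Ω)) (Y : Ω → ℝ) : Prop :=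
  ∀ ε : ℝ≥0∞, 0 < ε → ∃ O : Set Ω, IsOpen O ∧ upperCapacity Ps O < ε ∧
    Continuous fun x : (Oᶜ : Set Ω) => Y x

theorem upperCapacity_mono {Ω : Type*} [MeasurableSpace Ω] (Ps : Set (ProbabilityMeasure Ω))
    {A B : Set Ω} (h : A ⊆ B) : upperCapacity Ps A ≤ upperCapacity Ps B :=
  iSup₂_mono fun _ _ => measure_mono h

theorem upperCapacity_iUnion_le {Ω ι : Type*} [MeasurableSpace Ω] [Countable ι]
    (Ps : Set (ProbabilityMeasure Ω)) (A : ι → Set Ω) :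
    upperCapacity Ps (⋃ i, A i) ≤ ∑' i, upperCapacity Ps (A i) :=
  iSup₂_le fun P hP => (measure_iUnion_le A).trans <|
    ENNReal.tsum_le_tsum fun i =>
      le_iSup₂ (f := fun (P : ProbabilityMeasure Ω) (_ : P ∈ Ps) => (P : Measure Ω) (A i)) P hP

theorem upperCapacity_union_le {Ω : Type*} [MeasurableSpace Ω] (Ps : Set (ProbabilityMeasure Ω))
    (A B : Set Ω) :
    upperCapacity Ps (A ∪ B) ≤ upperCapacity Ps A + upperCapacity Ps B :=
  iSup₂_le fun P hP => (measure_union_le A B).trans <| add_le_add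
    (le_iSup₂ (f := fun (P : ProbabilityMeasure Ω) (_ : P ∈ Ps) => (P : Measure Ω) A) P hP)
    (le_iSup₂ (f := fun (P : ProbabilityMeasure Ω) (_ : P ∈ Ps) => (P : Measure Ω) B) P hP)

theorem upperCapacity_iUnion_null {Ω ι : Type*} [MeasurableSpace Ω] [Countable ι]
    (Ps : Set (ProbabilityMeasure Ω)) {A : ι → Set Ω} (h : ∀ i, upperCapacity Ps (A i) = 0) :
    upperCapacity Ps (⋃ i, A i) = 0 :=
  le_antisymm ((upperCapacity_iUnion_le Ps A).trans (by simp [h])) zero_le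

theorem upperCapacity_union_null {Ω : Type*} [MeasurableSpace Ω]
    (Ps : Set (ProbabilityMeasure Ω)) {A B : Set Ω} (hA : upperCapacity Ps A = 0)
    (hB : upperCapacity Ps B = 0) : upperCapacity Ps (A ∪ B) = 0 :=
  le_antisymm ((upperCapacity_union_le Ps A B).trans (by simp [hA, hB])) zero_le

theorem upperCapacity_null_mono {Ω : Type*} [MeasurableSpace Ω]
    (Ps : Set (ProbabilityMeasure Ω)) {A B : Set Ω} (h : A ⊆ B) (hB : upperCapacity Ps B = 0) :
    upperCapacity Ps A = 0 :=
  le_antisymm ((upperCapacity_mono Ps h).trans hB.le) zero_le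

/-- Real sequences that are Cauchy with modulus `K` converge to their limsup at the same rate. -/
theorem abs_sub_limsup_le {K : ℕ → ℕ} {f : ℕ → ℝ}
    (hf : ∀ k m n : ℕ, K k ≤ m → K k ≤ n → |f n - f m| ≤ 1 / ((k : ℝ) + 1))
    {k n : ℕ} (hn : K k ≤ n) : |f n - limsup f atTop| ≤ 1 / ((k : ℝ) + 1) := by
  have hc : CauchySeq f := by
    rw [Metric.cauchySeq_iff]
    intro ε hε
    obtain ⟨j, hj⟩ := exists_nat_one_div_lt hε
    exact ⟨K j, fun m hm n hn => (hf j n m hn hm).trans_lt hj⟩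
  obtain ⟨l, hl⟩ := cauchySeq_tendsto_of_complete hc
  rw [hl.limsup_eq]
  exact le_of_tendsto (hl.const_sub (f n)).abs
    (eventually_atTop.2 ⟨K k, fun m hm => hf k m n hm hn⟩)

/-- A sequence of quasi-continuous functions which is quasi-surely uniformly Cauchy has a
quasi-continuous limsup: the points where the Cauchy estimates fail form, together with an open set
off which all the functions are continuous, an open set of the same capacity. -/
theorem UpperQuasiContinuous.limsup_of_uniformly_cauchy
    {Ω : Type*} [TopologicalSpace Ω] [MeasurableSpace Ω] {Ps : Set (ProbabilityMeasure Ω)}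
    {Z : ℕ → Ω → ℝ} (hZ : ∀ n, UpperQuasiContinuous Ps (Z n)) {K : ℕ → ℕ}
    (hK : ∀ k m n : ℕ, K k ≤ m → K k ≤ n →
      upperCapacity Ps {ω | 1 / ((k : ℝ) + 1) < |Z n ω - Z m ω|} = 0) :
    UpperQuasiContinuous Ps fun ω => limsup (fun n => Z n ω) atTop := by
  intro ε hε
  obtain ⟨δ, hδ, hδε⟩ := ENNReal.exists_pos_sum_of_countable' hε.ne' ℕ
  choose O hO hOδ hOc using fun n => hZ n (δ n) (hδ n)
  let T := {p : ℕ × ℕ × ℕ // K p.1 ≤ p.2.1 ∧ K p.1 ≤ p.2.2}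
  let B : T → Set Ω := fun p =>
    {ω | 1 / ((p.1.1 : ℝ) + 1) < |Z p.1.2.2 ω - Z p.1.2.1 ω|}
  have hB : upperCapacity Ps (⋃ p, B p) = 0 :=
    upperCapacity_iUnion_null Ps fun p => hK _ _ _ p.2.1 p.2.2
  have hcont : ∀ n, ContinuousOn (Z n) (⋃ n, O n)ᶜ := fun n =>
    (continuousOn_iff_continuous_domRestrict.2 (hOc n)).mono
      (Set.compl_subset_compl.2 (Set.subset_iUnion O n))
  have hOopen : IsOpen (⋃ n, O n) := isOpen_iUnion hO
  have hopen : ∀ p, IsOpen ((⋃ n, O n) ∪ B p) := fun p => by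
    have := ((hcont p.1.2.2).sub (hcont p.1.2.1)).abs.preimage_isClosed_of_isClosed
      hOopen.isClosed_compl (isClosed_Iic (a := 1 / ((p.1.1 : ℝ) + 1)))
    convert this.isOpen_compl using 1
    ext ω
    simp [B, imp_iff_not_or]
  refine ⟨(⋃ n, O n) ∪ ⋃ p, B p, ?_, ?_, ?_⟩
  · convert hOopen.union (isOpen_iUnion hopen) using 1
    exact (Set.union_subset_union_right _ (Set.iUnion_mono fun _ => Set.subset_union_right)).antisymm
      (Set.union_subset Set.subset_union_left (Set.iUnion_subset fun p =>
        Set.union_subset_union_right _ (Set.subset_iUnion B p)))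
  · calc _ ≤ upperCapacity Ps (⋃ n, O n) + upperCapacity Ps (⋃ p, B p) :=
          upperCapacity_union_le _ _ _
      _ ≤ ∑' n, δ n := by
          rw [hB, add_zero]
          exact (upperCapacity_iUnion_le _ _).trans (ENNReal.tsum_le_tsum fun n => (hOδ n).le)
      _ < ε := hδε
  · have hlim : TendstoUniformlyOn Z (fun ω => limsup (fun n => Z n ω) atTop) atTop
        ((⋃ n, O n) ∪ ⋃ p, B p)ᶜ := by
      rw [Metric.tendstoUniformlyOn_iff]
      intro η hη
      obtain ⟨k, hk⟩ := exists_nat_one_div_lt hη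
      filter_upwards [eventually_ge_atTop (K k)] with n hn ω hω
      rw [dist_comm]
      refine (abs_sub_limsup_le (f := fun n => Z n ω) (fun j m n hm hn => ?_) hn).trans_lt hk
      by_contra! h
      exact hω (Or.inr (Set.mem_iUnion.2 ⟨⟨(j, m, n), hm, hn⟩, h⟩))
    exact continuousOn_iff_continuous_domRestrict.1 <| hlim.continuousOn <| Frequently.of_forall
      fun n => (hcont n).mono (Set.compl_subset_compl.2 Set.subset_union_left)

/-- `𝕃^∞_c` is a closed subspace of `𝕃^∞`: if `(Xₙ)` is a sequence of
Borel functions, each bounded quasi-surely and admitting a quasi-continuous version,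
which is Cauchy for the quasi-sure sup-norm (for every `ε > 0` eventually
`|Xₙ - Xₘ| ≤ ε` quasi-surely), then `(Xₙ)` converges in this norm to a Borel function
which is bounded quasi-surely and admits a quasi-continuous version. -/
theorem Linfty_c_closed
    {Ω : Type*} [MetricSpace Ω] [CompleteSpace Ω] [TopologicalSpace.SeparableSpace Ω]
    [MeasurableSpace Ω] [BorelSpace Ω]
    (Ps : Set (ProbabilityMeasure Ω)) (hPs : Ps.Nonempty)
    (X : ℕ → Ω → ℝ) (hXmeas : ∀ n, Measurable (X n))
    (hXbdd : ∀ n, ∃ M : ℝ, upperCapacity Ps {ω | M < |X n ω|} = 0)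
    (hXqc : ∀ n, ∃ Z : Ω → ℝ, UpperQuasiContinuous Ps Z ∧
      ∃ N : Set Ω, MeasurableSet N ∧ upperCapacity Ps N = 0 ∧ ∀ ω ∉ N, X n ω = Z ω)
    (hCauchy : ∀ ε : ℝ, 0 < ε → ∃ N : ℕ, ∀ m n : ℕ, N ≤ m → N ≤ n →
      upperCapacity Ps {ω | ε < |X n ω - X m ω|} = 0) :
    ∃ Y : Ω → ℝ, Measurable Y ∧
      (∃ M : ℝ, upperCapacity Ps {ω | M < |Y ω|} = 0) ∧
      (∃ Z : Ω → ℝ, UpperQuasiContinuous Ps Z ∧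
        ∃ N : Set Ω, MeasurableSet N ∧ upperCapacity Ps N = 0 ∧ ∀ ω ∉ N, Y ω = Z ω) ∧
      (∀ ε : ℝ, 0 < ε → ∃ N : ℕ, ∀ n : ℕ, N ≤ n →
        upperCapacity Ps {ω | ε < |X n ω - Y ω|} = 0) := by
  choose K hK using fun k : ℕ => hCauchy (1 / ((k : ℝ) + 1)) Nat.one_div_pos_of_nat
  choose Z hZ N hNmeas hN hXZ using hXqc
  have hconv : ∀ ε : ℝ, 0 < ε → ∃ J : ℕ, ∀ n : ℕ, J ≤ n →
      upperCapacity Ps {ω | ε < |X n ω - limsup (fun n => X n ω) atTop|} = 0 := by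
    intro ε hε
    obtain ⟨k, hk⟩ := exists_nat_one_div_lt hε
    refine ⟨K k, fun n hn => upperCapacity_null_mono Ps (fun ω hω => ?_)
      (upperCapacity_iUnion_null Ps fun p : {p : ℕ × ℕ × ℕ // K p.1 ≤ p.2.1 ∧ K p.1 ≤ p.2.2} =>
        hK _ _ _ p.2.1 p.2.2)⟩
    by_contra hgood
    refine (hk.trans hω).not_ge
      (abs_sub_limsup_le (f := fun n => X n ω) (fun j m n hm hn => ?_) hn)
    by_contra! h
    exact hgood (Set.mem_iUnion.2 ⟨⟨(j, m, n), hm, hn⟩, h⟩)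
  refine ⟨fun ω => limsup (fun n => X n ω) atTop, Measurable.limsup hXmeas, ?_,
    ⟨fun ω => limsup (fun n => Z n ω) atTop, ?_, ⋃ n, N n, MeasurableSet.iUnion hNmeas,
      upperCapacity_iUnion_null Ps hN, fun ω hω => ?_⟩, hconv⟩
  · obtain ⟨n, hn⟩ := hconv 1 one_pos
    obtain ⟨M, hM⟩ := hXbdd n
    refine ⟨M + 1, upperCapacity_null_mono Ps (fun ω hω => ?_)
      (upperCapacity_union_null Ps hM (hn n le_rfl))⟩
    by_contra! h
    simp only [Set.mem_union, Set.mem_ofPred_eq, not_or, not_lt] at h hω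
    grind
  · refine UpperQuasiContinuous.limsup_of_uniformly_cauchy hZ (K := K) fun k m n hm hn =>
      upperCapacity_null_mono Ps (fun ω hω => ?_) (upperCapacity_union_null Ps (hK k m n hm hn)
        (upperCapacity_union_null Ps (hN m) (hN n)))
    by_contra h
    simp only [Set.mem_union, Set.mem_ofPred_eq, not_or] at h hω
    rw [hXZ n ω h.2.2, hXZ m ω h.2.1] at h
    exact h.1 hω
  · simp only [Set.mem_iUnion, not_exists] at hω
    simp only [fun n => hXZ n ω (hω n)]
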